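/- Let Ω ⊂ ℝ^s be a convex body containing the unisolvent set σ = {x_1,…,x_m}, let f ∈ C^{d,1}(Ω), and suppose the closed ball B_h(x̄) is contained in Ω; set K = B_h(x̄) and y = (f(x_1),…,f(x_m)). Then for every multi-index ν ∈ ℕ_0^s with |ν| ≤ d, |D^ν f(x̄) − D^ν p[y,σ](x̄)| ≤ ‖f‖_{d,1}^K · k_d · M_{d,ν} · Λ_d(σ) · h^{d−|ν|+1}. -/

import Mathlib

open scoped BigOperators

noncomputable section

/-- Coordinate partial derivative along the `k`-th coordinate direction. -/
def pd (s : ℕ) (k : Fin s) (g : EuclideanSpace ℝ (Fin s) → ℝ) :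
    EuclideanSpace ℝ (Fin s) → ℝ :=
  fun x => fderiv ℝ g x (EuclideanSpace.single k 1)

/-- Multi-index partial derivative `D^ν`. -/
def Dmulti (s : ℕ) (ν : Fin s → ℕ) (g : EuclideanSpace ℝ (Fin s) → ℝ) :
    EuclideanSpace ℝ (Fin s) → ℝ :=
  (List.finRange s).foldr (fun k acc => (pd s k)^[ν k] acc) g

/-- The length `|ν|` of a multi-index. -/
def mdeg (s : ℕ) (ν : Fin s → ℕ) : ℕ := ∑ k, ν k

/-- The factorial `ν!` of a multi-index. -/
def mfact (s : ℕ) (ν : Fin s → ℕ) : ℕ := ∏ k, Nat.factorial (ν k)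

/-- The monomial power `z^ν`. -/
def mpow (s : ℕ) (z : EuclideanSpace ℝ (Fin s)) (ν : Fin s → ℕ) : ℝ :=
  ∏ k, (z k) ^ (ν k)

/-- The Taylor polynomial of order `d` of `f` centered at `xbar`, evaluated at `x`:
`T_d[f,x̄](x) = Σ_{|β|≤d} D^β f(x̄) (x−x̄)^β / β!`. -/
def taylorP (s d : ℕ) (f : EuclideanSpace ℝ (Fin s) → ℝ)
    (xbar x : EuclideanSpace ℝ (Fin s)) : ℝ :=
  ∑ β : Fin s → Fin (d+1),
    if mdeg s (fun k => (β k : ℕ)) ≤ d then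
      Dmulti s (fun k => (β k : ℕ)) f xbar * mpow s (x - xbar) (fun k => (β k : ℕ)) /
        (mfact s (fun k => (β k : ℕ)) : ℝ)
    else 0

/-- The Taylor remainder `R_T[f,x̄](x) = f(x) − T_d[f,x̄](x)`. -/
def taylorR (s d : ℕ) (f : EuclideanSpace ℝ (Fin s) → ℝ)
    (xbar x : EuclideanSpace ℝ (Fin s)) : ℝ :=
  f x - taylorP s d f xbar x

/-- `f ∈ C^{d,1}(Ω)`: `f` is `C^d` on `Ω` and all its order-`d` partial derivatives are
Lipschitz continuous on `Ω`. -/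
def Cd1 (s d : ℕ) (f : EuclideanSpace ℝ (Fin s) → ℝ)
    (Ω : Set (EuclideanSpace ℝ (Fin s))) : Prop :=
  ContDiffOn ℝ d f Ω ∧
    ∀ ν : Fin s → ℕ, mdeg s ν = d → ∃ L : NNReal, LipschitzOnWith L (Dmulti s ν f) Ω

/-- The seminorm `‖f‖_{d,1}^K`. -/
def semi (s d : ℕ) (f : EuclideanSpace ℝ (Fin s) → ℝ)
    (K : Set (EuclideanSpace ℝ (Fin s))) : ℝ :=
  sSup { r : ℝ | ∃ (ν : Fin s → ℕ) (u v : EuclideanSpace ℝ (Fin s)),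
    mdeg s ν = d ∧ u ∈ K ∧ v ∈ K ∧ u ≠ v ∧
    r = |Dmulti s ν f u - Dmulti s ν f v| / ‖u - v‖ }

/-- The constants `k_j = s^j/(j−1)!` for `j > 0`, `k_0 = 1`. -/
def kconst (s j : ℕ) : ℝ :=
  if j = 0 then 1 else (s : ℝ) ^ j / (Nat.factorial (j - 1) : ℝ)

/-- `M_{d,ν} = Π_{j=0}^{|ν|−1} (d−j)^2`. -/
def Mconst (d : ℕ) {s : ℕ} (ν : Fin s → ℕ) : ℝ :=
  ∏ j ∈ Finset.range (mdeg s ν), ((d : ℝ) - (j : ℝ)) ^ 2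

/-- The node set is unisolvent for polynomial interpolation of total degree at most `d`. -/
def Unisolvent (s d m : ℕ) (x : Fin m → EuclideanSpace ℝ (Fin s)) : Prop :=
  Function.Injective x ∧
    ∀ y : Fin m → ℝ, ∃! p : MvPolynomial (Fin s) ℝ,
      p.totalDegree ≤ d ∧ ∀ i, MvPolynomial.eval (fun k => x i k) p = y i

/-- `ℓ` is the family of fundamental Lagrange polynomials of the nodes `x`. -/
def IsLagrangeBasis (s d m : ℕ) (x : Fin m → EuclideanSpace ℝ (Fin s))
    (ℓ : Fin m → MvPolynomial (Fin s) ℝ) : Prop :=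
  (∀ i, (ℓ i).totalDegree ≤ d) ∧
    ∀ i j, MvPolynomial.eval (fun k => x j k) (ℓ i) = if i = j then (1 : ℝ) else 0

/-- The interpolating polynomial `p[y,σ] = Σ_i y_i ℓ_i`, as a function. -/
def interp (s m : ℕ) (ℓ : Fin m → MvPolynomial (Fin s) ℝ) (y : Fin m → ℝ) :
    EuclideanSpace ℝ (Fin s) → ℝ :=
  fun x => ∑ i, y i * MvPolynomial.eval (fun k => x k) (ℓ i)

/-- The Lebesgue constant `Λ_d(σ) = max_{x ∈ Ω} Σ_i |ℓ_i(x)|`. -/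
def lebesgue (s m : ℕ) (ℓ : Fin m → MvPolynomial (Fin s) ℝ)
    (Ω : Set (EuclideanSpace ℝ (Fin s))) : ℝ :=
  sSup ((fun x : EuclideanSpace ℝ (Fin s) =>
    ∑ i, |MvPolynomial.eval (fun k => x k) (ℓ i)|) '' Ω)

/-- Maximum absolute column sum (operator `1`-)norm of a square matrix. -/
def onenorm (m : ℕ) (M : Matrix (Fin m) (Fin m) ℝ) : ℝ := ⨆ j, ∑ i, |M i j|


theorem schur_end (n : ℕ) (U : Polynomial ℝ) (hU : U.degree < n) (M : ℝ)
    (hM : ∀ θ : ℝ, |Real.sin θ * U.eval (Real.cos θ)| ≤ M) : |U.eval 1| ≤ n * M := by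
  rcases Nat.eq_zero_or_pos n with rfl | hn
  · have : U = 0 := by
      rw [← Polynomial.degree_eq_bot]
      exact Nat.WithBot.lt_zero_iff.mp (by simpa using hU)
    simp [this]
  have hn' : (0 : ℝ) < n := by exact_mod_cast hn
  set t : ℕ → ℝ := fun k => (2 * k + 1) * Real.pi / (2 * n) with ht
  set v : ℕ → ℝ := fun k => Real.cos (t k) with hv
  have ht0 : ∀ k, 0 < t k := fun k => by simp only [ht]; positivity
  have htpi : ∀ k ∈ Finset.range n, t k < Real.pi := by
    intro k hk
    have hk' : (k : ℝ) + 1 ≤ n := by exact_mod_cast Finset.mem_range.mp hk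
    simp only [ht]
    rw [div_lt_iff₀ (by positivity)]
    nlinarith [Real.pi_pos]
  have htmono : ∀ i j, i < j → t i < t j := by
    intro i j hij
    have : (i : ℝ) < j := by exact_mod_cast hij
    simp only [ht]
    gcongr
  have hvanti : ∀ i ∈ Finset.range n, ∀ j ∈ Finset.range n, i < j → v j < v i := by
    intro i hi j hj hij
    exact Real.cos_lt_cos_of_nonneg_of_le_pi (ht0 i).le (htpi j hj).le (htmono i j hij)
  have hinj : Set.InjOn v (Finset.range n) := by
    intro i hi j hj hij
    rcases lt_trichotomy i j with h | h | h
    · exact absurd hij (hvanti i hi j hj h).ne'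
    · exact h
    · exact absurd hij (hvanti j hj i hi h).ne
  have hv1 : ∀ k ∈ Finset.range n, v k < 1 := by
    intro k hk
    have := Real.cos_lt_cos_of_nonneg_of_le_pi (le_refl 0) (htpi k hk).le (ht0 k)
    simpa using this
  have hsin : ∀ k ∈ Finset.range n, 0 < Real.sin (t k) := fun k hk =>
    Real.sin_pos_of_pos_of_lt_pi (ht0 k) (htpi k hk)
  set c : ℕ → ℝ := fun k => (Lagrange.basis (Finset.range n) v k).eval 1 with hc
  have hsum : ∀ P : Polynomial ℝ, P.degree < n → P.eval 1 =
      ∑ k ∈ Finset.range n, P.eval (v k) * c k := by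
    intro P hP
    conv_lhs => rw [Lagrange.eq_interpolate hinj (f := P) (by simpa using hP)]
    simp [Lagrange.interpolate_apply, Polynomial.eval_finsetSum, hc]
  have hsign : ∀ k ∈ Finset.range n, 0 ≤ (-1) ^ k * c k := by
    intro k hk
    have h1 : (-1 : ℝ) ^ k = ∏ j ∈ (Finset.range n).erase k, (if j < k then (-1 : ℝ) else 1) := by
      rw [Finset.prod_ite]
      simp only [Finset.prod_const, one_pow, mul_one]
      congr 1
      have : ((Finset.range n).erase k).filter (fun j => j < k) = Finset.range k := by
        ext j
        have := Finset.mem_range.mp hk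
        simp only [Finset.mem_filter, Finset.mem_erase, Finset.mem_range]
        omega
      rw [this, Finset.card_range]
    simp only [hc]
    rw [h1, Lagrange.basis, Polynomial.eval_prod, ← Finset.prod_mul_distrib]
    apply Finset.prod_nonneg
    intro j hj
    rw [Finset.mem_erase] at hj
    have hj1 := hv1 j hj.2
    simp only [Lagrange.basisDivisor, Polynomial.eval_mul, Polynomial.eval_C, Polynomial.eval_sub,
      Polynomial.eval_X]
    split_ifs with h
    · have h2 := hvanti j hj.2 k hk h
      have : (v k - v j)⁻¹ ≤ 0 := inv_nonpos.mpr (by linarith)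
      nlinarith
    · have h2 := hvanti k hk j hj.2 (by omega)
      have : 0 ≤ (v k - v j)⁻¹ := inv_nonneg.mpr (by linarith)
      nlinarith
  have hcheb : (n : ℝ) = ∑ k ∈ Finset.range n, (-1) ^ k / Real.sin (t k) * c k := by
    have h1 := hsum (Polynomial.Chebyshev.U ℝ ((n - 1 : ℕ) : ℤ)) (by
      rw [Polynomial.Chebyshev.degree_U_natCast]
      exact_mod_cast Nat.sub_lt hn one_pos)
    rw [Polynomial.Chebyshev.U_eval_one] at h1
    have h2 : (((n - 1 : ℕ) : ℤ) : ℝ) + 1 = n := by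
      rw [Nat.cast_sub (by omega)]; push_cast; ring
    rw [h2] at h1
    rw [h1]
    apply Finset.sum_congr rfl
    intro k hk
    congr 1
    rw [eq_div_iff (hsin k hk).ne']
    simp only [hv]
    rw [Polynomial.Chebyshev.U_real_cos, h2]
    have : (n : ℝ) * t k = k * Real.pi + Real.pi / 2 := by
      simp only [ht]; field_simp
    rw [this, Real.sin_add_pi_div_two, Real.cos_nat_mul_pi]
  rw [hsum U hU]
  conv_rhs => rw [hcheb]
  rw [Finset.sum_mul]
  refine (Finset.abs_sum_le_sum_abs _ _).trans (Finset.sum_le_sum ?_)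
  intro k hk
  have hs := hsin k hk
  have h1 := hM (t k)
  rw [abs_mul, abs_of_pos hs] at h1
  have h2 : |U.eval (v k)| ≤ M / Real.sin (t k) := by
    rw [le_div_iff₀ hs]; linarith
  have h3 : |c k| = (-1) ^ k * c k := by
    have := abs_of_nonneg (hsign k hk)
    rwa [abs_mul, abs_pow, abs_neg, abs_one, one_pow, one_mul] at this
  rw [abs_mul]
  calc |U.eval (v k)| * |c k| ≤ M / Real.sin (t k) * |c k| := by gcongr
    _ = _ := by rw [h3]; ring

/-- restriction to an ellipse -/
theorem ellipse_repr {s : ℕ} (a u w : Fin s → ℝ) (p : MvPolynomial (Fin s) ℝ) (n : ℕ)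
    (hp : p.totalDegree ≤ n) :
    ∃ E U : Polynomial ℝ, U.degree < n ∧ ∀ θ : ℝ,
      MvPolynomial.eval (fun k => a k + Real.cos θ * u k + Real.sin θ * w k) p =
        E.eval (Real.cos θ) + Real.sin θ * U.eval (Real.cos θ) := by
  have key : ∀ (t : Multiset (Fin s)), ∃ E U : Polynomial ℝ, E.degree ≤ Multiset.card t ∧
      U.degree < Multiset.card t ∧ ∀ θ : ℝ,
      (t.map (fun k => a k + Real.cos θ * u k + Real.sin θ * w k)).prod =
        E.eval (Real.cos θ) + Real.sin θ * U.eval (Real.cos θ) := by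
    intro t
    induction t using Multiset.induction_on with
    | empty => exact ⟨1, 0, by simp, by simp, by simp⟩
    | cons k t ih =>
      obtain ⟨E, U, hE, hU, h⟩ := ih
      refine ⟨(Polynomial.C (a k) + Polynomial.C (u k) * Polynomial.X) * E +
        Polynomial.C (w k) * (1 - Polynomial.X ^ 2) * U,
        (Polynomial.C (a k) + Polynomial.C (u k) * Polynomial.X) * U + Polynomial.C (w k) * E,
        ?_, ?_, ?_⟩
      · rw [Multiset.card_cons]
        rw [Polynomial.degree_le_iff_coeff_zero] at *
        rw [Polynomial.degree_lt_iff_coeff_zero] at hU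
        intro m hm
        have hm' : Multiset.card t + 1 < m := by exact_mod_cast hm
        obtain ⟨m, rfl⟩ : ∃ m', m = m' + 2 := ⟨m - 2, by omega⟩
        have e1 := hE (m+2) (by exact_mod_cast (by omega))
        have e2 := hE (m+1) (by exact_mod_cast (by omega))
        have e3 := hU (m+2) (by omega)
        have e4 := hU m (by omega)
        simp [add_mul, mul_assoc, sub_mul, Polynomial.coeff_X_mul, Polynomial.coeff_X_pow_mul, e1, e2, e3, e4]
      · rw [Multiset.card_cons]
        rw [Polynomial.degree_le_iff_coeff_zero] at *
        rw [Polynomial.degree_lt_iff_coeff_zero] at *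
        intro m hm
        obtain ⟨m, rfl⟩ : ∃ m', m = m' + 1 := ⟨m - 1, by omega⟩
        have e1 := hE (m+1) (by exact_mod_cast (by omega))
        have e3 := hU (m+1) (by omega)
        have e4 := hU m (by omega)
        simp [add_mul, mul_assoc, Polynomial.coeff_X_mul, e1, e3, e4]
      · intro θ
        rw [Multiset.map_cons, Multiset.prod_cons, h]
        simp only [Polynomial.eval_add, Polynomial.eval_mul, Polynomial.eval_C, Polynomial.eval_X,
          Polynomial.eval_sub, Polynomial.eval_one, Polynomial.eval_pow]
        have := Real.sin_sq_add_cos_sq θ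
        linear_combination (w k * Polynomial.eval (Real.cos θ) U) * this
  choose E U hE hU h using key
  refine ⟨∑ m ∈ p.support, Polynomial.C (p.coeff m) * E (Finsupp.toMultiset m),
    ∑ m ∈ p.support, Polynomial.C (p.coeff m) * U (Finsupp.toMultiset m), ?_, ?_⟩
  · rw [Polynomial.degree_lt_iff_coeff_zero]
    intro j hj
    rw [Polynomial.finsetSum_coeff]
    apply Finset.sum_eq_zero
    intro m hm
    have := hU (Finsupp.toMultiset m)
    rw [Polynomial.degree_lt_iff_coeff_zero] at this
    rw [Polynomial.coeff_C_mul, this j, mul_zero]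
    have h2 := MvPolynomial.le_totalDegree hm
    rw [Finsupp.card_toMultiset]
    exact (h2.trans hp).trans hj
  · intro θ
    rw [MvPolynomial.eval_eq', Polynomial.eval_finsetSum, Polynomial.eval_finsetSum,
      Finset.mul_sum, ← Finset.sum_add_distrib]
    apply Finset.sum_congr rfl
    intro m hm
    have := h (Finsupp.toMultiset m) θ
    rw [Finset.prod_multiset_map_count] at this
    simp only [Finsupp.count_toMultiset, Finsupp.toFinset_toMultiset] at this
    rw [Finset.prod_subset (Finset.subset_univ _) (by
      intro i _ hi
      rw [Finsupp.notMem_support_iff.mp hi, pow_zero])] at this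
    rw [this]
    simp only [Polynomial.eval_mul, Polynomial.eval_C]
    ring

theorem pd_eval {s : ℕ} (p : MvPolynomial (Fin s) ℝ) (x : EuclideanSpace ℝ (Fin s)) :
    HasFDerivAt (fun z : EuclideanSpace ℝ (Fin s) => MvPolynomial.eval (fun k => z k) p)
      (∑ k, MvPolynomial.eval (fun k => x k) (MvPolynomial.pderiv k p) •
        (EuclideanSpace.proj k : EuclideanSpace ℝ (Fin s) →L[ℝ] ℝ)) x := by
  induction p using MvPolynomial.induction_on with
  | C a => simpa using hasFDerivAt_const a x
  | add p q hp hq =>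
    simp only [map_add, add_smul, Finset.sum_add_distrib]
    exact hp.add hq
  | mul_X p i hp =>
    have h1 : HasFDerivAt (fun z : EuclideanSpace ℝ (Fin s) => z i)
      (EuclideanSpace.proj i : EuclideanSpace ℝ (Fin s) →L[ℝ] ℝ) x :=
      (EuclideanSpace.proj i : EuclideanSpace ℝ (Fin s) →L[ℝ] ℝ).hasFDerivAt
    have h2 := hp.mul h1
    simp only [map_mul, MvPolynomial.eval_X]
    refine HasFDerivAt.congr_fderiv h2 ?_
    ext z
    simp [MvPolynomial.pderiv_X, Finset.sum_add_distrib, add_mul,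
      Finset.mul_sum, Pi.single_apply, apply_ite]
    apply Finset.sum_congr rfl
    intros; ring

theorem pd_eval' {s : ℕ} (k : Fin s) (p : MvPolynomial (Fin s) ℝ) :
    pd s k (fun z => MvPolynomial.eval (fun k => z k) p) =
      fun z => MvPolynomial.eval (fun k => z k) (MvPolynomial.pderiv k p) := by
  funext x
  rw [pd, (pd_eval p x).fderiv]
  simp

theorem contDiff_eval {s : ℕ} (p : MvPolynomial (Fin s) ℝ) (n : WithTop ℕ∞) :
    ContDiff ℝ n (fun z : EuclideanSpace ℝ (Fin s) => MvPolynomial.eval (fun k => z k) p) := by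
  induction p using MvPolynomial.induction_on with
  | C a => simpa using contDiff_const
  | add p q hp hq => simpa using hp.add hq
  | mul_X p i hp =>
    simp only [map_mul, MvPolynomial.eval_X]
    exact hp.mul (EuclideanSpace.proj i : EuclideanSpace ℝ (Fin s) →L[ℝ] ℝ).contDiff

theorem bernstein_ball {s : ℕ} (n : ℕ) (p : MvPolynomial (Fin s) ℝ) (hp : p.totalDegree ≤ n)
    (a x : EuclideanSpace ℝ (Fin s)) (r M δ : ℝ) (hδ : 0 ≤ δ) (hr : 0 ≤ r)
    (hM : ∀ z ∈ Metric.closedBall a r, |MvPolynomial.eval (fun k => z k) p| ≤ M)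
    (hx : ‖x - a‖ ^ 2 + δ ^ 2 ≤ r ^ 2) (k : Fin s) :
    |MvPolynomial.eval (fun k => x k) (MvPolynomial.pderiv k p)| * δ ≤ n * M := by
  set w : EuclideanSpace ℝ (Fin s) := EuclideanSpace.single k δ with hw
  have hwn : ‖w‖ = δ := by simp [hw, abs_of_nonneg hδ]
  set c : ℝ → EuclideanSpace ℝ (Fin s) := fun θ => a + Real.cos θ • (x - a) + Real.sin θ • w with hc
  have hcb : ∀ θ, c θ ∈ Metric.closedBall a r := by
    intro θ
    rw [Metric.mem_closedBall, dist_eq_norm]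
    have : c θ - a = Real.cos θ • (x - a) + Real.sin θ • w := by simp [hc, add_assoc]
    rw [this]
    refine (norm_add_le _ _).trans ?_
    rw [norm_smul, norm_smul, hwn, Real.norm_eq_abs, Real.norm_eq_abs]
    apply abs_le_of_sq_le_sq' _ hr |>.2
    have h1 : |Real.cos θ| ^ 2 + |Real.sin θ| ^ 2 = 1 := by
      rw [sq_abs, sq_abs]; exact Real.cos_sq_add_sin_sq θ
    nlinarith [sq_nonneg (|Real.cos θ| * δ - |Real.sin θ| * ‖x - a‖)]
  obtain ⟨E, U, hU, hEU⟩ := ellipse_repr (fun k => a k) (fun k => (x - a) k) (fun k => w k) p n hp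
  have hEU' : ∀ θ, MvPolynomial.eval (fun k => (c θ) k) p =
        E.eval (Real.cos θ) + Real.sin θ * U.eval (Real.cos θ) := by
    intro θ
    rw [← hEU θ]
    simp [hc]
  have hb : ∀ θ : ℝ, |Real.sin θ * U.eval (Real.cos θ)| ≤ M := by
    intro θ
    have h1 := hM _ (hcb θ)
    have h2 := hM _ (hcb (-θ))
    rw [hEU'] at h1 h2
    rw [Real.cos_neg, Real.sin_neg] at h2
    rw [abs_le] at *
    constructor <;> linarith
  have hS := schur_end n U hU M hb
  have hd1 : HasDerivAt (fun θ => MvPolynomial.eval (fun k => (c θ) k) p)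
      (MvPolynomial.eval (fun k => x k) (MvPolynomial.pderiv k p) * δ) 0 := by
    have hc' : HasDerivAt c w 0 := by
      have h1 := (Real.hasDerivAt_cos 0).smul_const (x - a)
      have h2 := (Real.hasDerivAt_sin 0).smul_const w
      have h3 := (h1.const_add a).add h2
      exact HasDerivAt.congr_deriv h3 (by simp)
    have hc0 : c 0 = x := by simp [hc]
    have h4 := (pd_eval p (c 0)).comp_hasDerivAt 0 hc'
    rw [hc0] at h4
    exact HasDerivAt.congr_deriv h4 (by simp [hw])
  have hd2 : HasDerivAt (fun θ => E.eval (Real.cos θ) + Real.sin θ * U.eval (Real.cos θ))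
      (U.eval 1) 0 := by
    have h1 := (E.hasDerivAt (Real.cos 0)).comp 0 (Real.hasDerivAt_cos 0)
    have h2 := (U.hasDerivAt (Real.cos 0)).comp 0 (Real.hasDerivAt_cos 0)
    have h3 := h1.add ((Real.hasDerivAt_sin 0).mul h2)
    exact HasDerivAt.congr_deriv h3 (by simp)
  have heq : (fun θ => MvPolynomial.eval (fun k => (c θ) k) p) =
    (fun θ => E.eval (Real.cos θ) + Real.sin θ * U.eval (Real.cos θ)) := funext hEU'
  rw [heq] at hd1
  have := hd1.unique hd2
  rw [← this, abs_mul, abs_of_nonneg hδ] at hS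
  exact hS

/-- iterated partial derivatives of a polynomial along a word -/
def pword {s : ℕ} (w : List (Fin s)) (p : MvPolynomial (Fin s) ℝ) : MvPolynomial (Fin s) ℝ :=
  w.foldr (fun k q => MvPolynomial.pderiv k q) p

theorem totalDegree_pderiv_le {s : ℕ} (k : Fin s) (p : MvPolynomial (Fin s) ℝ) :
    (MvPolynomial.pderiv k p).totalDegree ≤ p.totalDegree - 1 := by
  rw [MvPolynomial.totalDegree, Finset.sup_le_iff]
  intro m hm
  rw [MvPolynomial.mem_support_iff, MvPolynomial.coeff_pderiv] at hm
  have h1 : m + Finsupp.single k 1 ∈ p.support := by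
    rw [MvPolynomial.mem_support_iff]
    intro h; simp [h] at hm
  have h2 := MvPolynomial.le_totalDegree h1
  rw [Finsupp.sum_add_index' (by simp) (by simp)] at h2
  simp at h2
  omega

theorem totalDegree_pword_le {s : ℕ} (w : List (Fin s)) (p : MvPolynomial (Fin s) ℝ) :
    (pword w p).totalDegree ≤ p.totalDegree - w.length := by
  induction w with
  | nil => simp [pword]
  | cons k w ih =>
    have := totalDegree_pderiv_le k (pword w p)
    simp only [pword, List.foldr_cons, List.length_cons] at *
    omega

theorem pword_bound {s : ℕ} (D : ℕ) (p : MvPolynomial (Fin s) ℝ) (hp : p.totalDegree ≤ D)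
    (a : EuclideanSpace ℝ (Fin s)) (h M δ : ℝ) (hδ : 0 < δ)
    (hM : ∀ z ∈ Metric.closedBall a h, |MvPolynomial.eval (fun k => z k) p| ≤ M) (hh : 0 ≤ h)
    (w : List (Fin s)) (hw : w.length ≤ D) :
    ∀ z : EuclideanSpace ℝ (Fin s), ‖z - a‖ ^ 2 + w.length * δ ^ 2 ≤ h ^ 2 →
      |MvPolynomial.eval (fun k => z k) (pword w p)| * δ ^ w.length ≤
        M * ∏ j ∈ Finset.range w.length, ((D : ℝ) - j) := by
  induction w with
  | nil =>
    intro z hz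
    have := hM z (by
      rw [Metric.mem_closedBall, dist_eq_norm]
      apply abs_le_of_sq_le_sq' _ hh |>.2
      simpa using hz)
    simpa [pword] using this
  | cons k w ih =>
    intro z hz
    have ih := ih (by simp at hw; omega)
    rw [List.length_cons] at hw hz ⊢
    push_cast at hz
    have h0 : 0 ≤ h ^ 2 - w.length * δ ^ 2 := by nlinarith [sq_nonneg ‖z - a‖, sq_nonneg δ]
    have hdeg := totalDegree_pword_le w p
    have hB := bernstein_ball (D - w.length) (pword w p) (by omega) a z
      (Real.sqrt (h ^ 2 - w.length * δ ^ 2))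
      (M * (∏ j ∈ Finset.range w.length, ((D : ℝ) - j)) / δ ^ w.length) δ hδ.le (Real.sqrt_nonneg _)
      (by
        intro z hz
        rw [Metric.mem_closedBall, dist_eq_norm] at hz
        rw [le_div_iff₀ (by positivity)]
        apply ih
        have : ‖z - a‖ ^ 2 ≤ Real.sqrt (h ^ 2 - w.length * δ ^ 2) ^ 2 := by gcongr
        rw [Real.sq_sqrt h0] at this
        linarith)
      (by rw [Real.sq_sqrt h0]; linarith) k
    rw [Finset.prod_range_succ, pow_succ]
    rw [Nat.cast_sub (by omega), mul_div_assoc', le_div_iff₀ (by positivity)] at hB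
    have e : pword (k :: w) p = MvPolynomial.pderiv k (pword w p) := rfl
    rw [e]
    linarith

theorem pow_self_le_factorial_sq (n : ℕ) : n ^ n ≤ n.factorial ^ 2 := by
  have h1 : n.factorial = ∏ i ∈ Finset.range n, (i + 1) := (Finset.prod_range_add_one_eq_factorial n).symm
  have h2 : n.factorial = ∏ i ∈ Finset.range n, (n - 1 - i + 1) := by
    rw [h1, ← Finset.prod_range_reflect]
  calc n ^ n = ∏ i ∈ Finset.range n, n := by simp
    _ ≤ ∏ i ∈ Finset.range n, ((i + 1) * (n - 1 - i + 1)) := by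
      apply Finset.prod_le_prod' 
      intro i hi
      have := Finset.mem_range.mp hi
      obtain ⟨j, rfl⟩ : ∃ j, n = i + j + 1 := ⟨n - i - 1, by omega⟩
      have : i + j + 1 - 1 - i = j := by omega
      rw [this]
      nlinarith
    _ = n.factorial ^ 2 := by rw [Finset.prod_mul_distrib, ← h1, ← h2, sq]

theorem pword_center {s : ℕ} (D : ℕ) (p : MvPolynomial (Fin s) ℝ) (hp : p.totalDegree ≤ D)
    (a : EuclideanSpace ℝ (Fin s)) (h M : ℝ) (hM0 : 0 ≤ M)
    (hM : ∀ z ∈ Metric.closedBall a h, |MvPolynomial.eval (fun k => z k) p| ≤ M) (hh : 0 < h)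
    (w : List (Fin s)) (hw : w.length ≤ D) :
      |MvPolynomial.eval (fun k => a k) (pword w p)| * h ^ w.length ≤
        M * ∏ j ∈ Finset.range w.length, ((D : ℝ) - j) ^ 2 := by
  rcases Nat.eq_zero_or_pos w.length with h0 | h0
  · rw [List.length_eq_zero_iff] at h0
    subst h0
    simpa [pword] using hM a (by simp [hh.le])
  set n := w.length with hn
  have hn0 : (0 : ℝ) < n := by exact_mod_cast h0
  have hB := pword_bound D p hp a h M (h / Real.sqrt n) (by positivity) hM hh.le w hw a (by
    rw [← hn, div_pow, Real.sq_sqrt hn0.le]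
    simp; field_simp; rfl)
  rw [← hn] at hB
  set P := ∏ j ∈ Finset.range n, ((D : ℝ) - j) with hP
  have hPf : (n.factorial : ℝ) ≤ P := by
    have h1 : P = (D.descFactorial n : ℝ) := by
      rw [Nat.descFactorial_eq_prod_range, Nat.cast_prod]
      apply Finset.prod_congr rfl
      intro i hi
      have := Finset.mem_range.mp hi
      rw [Nat.cast_sub (by omega)]
    rw [h1, ← Nat.descFactorial_self n]
    exact_mod_cast Nat.descFactorial_le n hw
  have hP0 : 0 ≤ P := le_trans (by positivity) hPf
  have hsq : Real.sqrt n ^ n ≤ P := by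
    refine le_trans ?_ hPf
    apply abs_le_of_sq_le_sq' _ (by positivity) |>.2
    rw [← pow_mul, mul_comm n 2, pow_mul, Real.sq_sqrt hn0.le]
    exact_mod_cast pow_self_le_factorial_sq n
  rw [Finset.prod_pow, ← hP]
  rw [div_pow, mul_div_assoc', div_le_iff₀ (by positivity)] at hB
  calc _ ≤ M * P * Real.sqrt n ^ n := hB
    _ ≤ M * P * P := by gcongr
    _ = _ := by ring

/-- iterated partial derivatives of a function along a word -/
def fword {s : ℕ} (w : List (Fin s)) (g : EuclideanSpace ℝ (Fin s) → ℝ) :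
    EuclideanSpace ℝ (Fin s) → ℝ :=
  w.foldr (fun k q => pd s k q) g

/-- the canonical word of a multi-index -/
def canon {s : ℕ} (ν : Fin s → ℕ) : List (Fin s) :=
  (List.finRange s).flatMap (fun k => List.replicate (ν k) k)

theorem foldr_canon {s : ℕ} {β : Type*} (F : Fin s → β → β) (ν : Fin s → ℕ) (g : β) :
    (canon ν).foldr F g = (List.finRange s).foldr (fun k acc => (F k)^[ν k] acc) g := by
  rw [canon]
  induction List.finRange s with
  | nil => rfl
  | cons k l ih =>
    rw [List.flatMap_cons, List.foldr_append, ih, List.foldr_cons]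
    generalize List.foldr (fun k acc => (F k)^[ν k] acc) g l = z
    induction ν k with
    | zero => rfl
    | succ n ihn => rw [List.replicate_succ, List.foldr_cons, ihn, Function.iterate_succ_apply']

theorem Dmulti_eq_fword {s : ℕ} (ν : Fin s → ℕ) (g : EuclideanSpace ℝ (Fin s) → ℝ) :
    Dmulti s ν g = fword (canon ν) g := (foldr_canon _ ν g).symm

theorem length_canon {s : ℕ} (ν : Fin s → ℕ) : (canon ν).length = mdeg s ν := by
  simp [canon, mdeg, List.length_flatMap, List.sum_ofFn, ← List.ofFn_eq_map]

theorem count_canon {s : ℕ} (ν : Fin s → ℕ) (k : Fin s) : (canon ν).count k = ν k := by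
  simp [canon, List.count_flatMap, List.count_replicate, Function.comp_def, ← List.ofFn_eq_map, List.sum_ofFn]

theorem perm_canon {s : ℕ} (w : List (Fin s)) : w.Perm (canon fun k => w.count k) := by
  rw [List.perm_iff_count]
  intro k
  rw [count_canon]

theorem fword_eval {s : ℕ} (w : List (Fin s)) (p : MvPolynomial (Fin s) ℝ) :
    fword w (fun z => MvPolynomial.eval (fun k => z k) p) =
      fun z => MvPolynomial.eval (fun k => z k) (pword w p) := by
  induction w with
  | nil => rfl
  | cons k w ih =>
    change pd s k (fword w _) = _
    rw [ih, pd_eval']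
    rfl

theorem pd_contDiffOn {s : ℕ} {V : Set (EuclideanSpace ℝ (Fin s))} (hV : IsOpen V) (n : ℕ)
    {g : EuclideanSpace ℝ (Fin s) → ℝ} (hg : ContDiffOn ℝ (n + 1 : ℕ) g V) (k : Fin s) :
    ContDiffOn ℝ n (pd s k g) V := by
  have h1 : ContDiffOn ℝ n (fderiv ℝ g) V := hg.fderiv_of_isOpen hV (by norm_cast)
  exact h1.clm_apply contDiffOn_const

theorem fword_contDiffOn {s : ℕ} {V : Set (EuclideanSpace ℝ (Fin s))} (hV : IsOpen V)
    {g : EuclideanSpace ℝ (Fin s) → ℝ} (w : List (Fin s)) (n : ℕ)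
    (hg : ContDiffOn ℝ (n + w.length : ℕ) g V) :
    ContDiffOn ℝ n (fword w g) V := by
  induction w generalizing n with
  | nil => exact hg
  | cons k w ih =>
    exact pd_contDiffOn hV n (ih (n + 1) (by
      rw [List.length_cons] at hg
      have e : n + 1 + w.length = n + (w.length + 1) := by ring
      rwa [e])) k

theorem pd_congr {s : ℕ} {V : Set (EuclideanSpace ℝ (Fin s))} (hV : IsOpen V)
    {f g : EuclideanSpace ℝ (Fin s) → ℝ} (hfg : Set.EqOn f g V) (k : Fin s) :
    Set.EqOn (pd s k f) (pd s k g) V := by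
  intro x hx
  have : f =ᶠ[nhds x] g := Filter.eventuallyEq_of_mem (hV.mem_nhds hx) hfg
  simp only [pd, this.fderiv_eq]

theorem pd_comm {s : ℕ} {V : Set (EuclideanSpace ℝ (Fin s))} (hV : IsOpen V)
    {g : EuclideanSpace ℝ (Fin s) → ℝ} (hg : ContDiffOn ℝ 2 g V) (k l : Fin s) :
    Set.EqOn (pd s k (pd s l g)) (pd s l (pd s k g)) V := by
  intro x hx
  have hgx : ContDiffAt ℝ 2 g x := hg.contDiffAt (hV.mem_nhds hx)
  have hsym := hgx.isSymmSndFDerivAt (by simp)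
  have hdiff : DifferentiableAt ℝ (fderiv ℝ g) x :=
    (hgx.fderiv_right (m := 1) (by norm_num)).differentiableAt (by norm_num)
  have key : ∀ k l : Fin s, pd s k (pd s l g) x =
      fderiv ℝ (fderiv ℝ g) x (EuclideanSpace.single k 1) (EuclideanSpace.single l 1) := by
    intro k l
    unfold pd
    rw [fderiv_clm_apply hdiff (by fun_prop)]
    simp
  rw [key, key, hsym.eq]

theorem fword_perm {s : ℕ} {V : Set (EuclideanSpace ℝ (Fin s))} (hV : IsOpen V)
    {g : EuclideanSpace ℝ (Fin s) → ℝ} {w w' : List (Fin s)} (hp : w.Perm w')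
    (hg : ContDiffOn ℝ w.length g V) :
    Set.EqOn (fword w g) (fword w' g) V := by
  induction hp with
  | nil => exact fun _ _ => rfl
  | cons k _ ih =>
    exact pd_congr hV (ih (hg.of_le (by simp))) k
  | swap k l w =>
    exact pd_comm hV (fword_contDiffOn hV w 2 (by
      simp only [List.length_cons] at hg
      have e : 2 + w.length = w.length + 1 + 1 := by ring
      rwa [e])) l k
  | trans h1 h2 ih1 ih2 =>
    exact (ih1 hg).trans (ih2 (by rwa [← h1.length_eq]))

theorem fword_sub {s : ℕ} {V : Set (EuclideanSpace ℝ (Fin s))} (hV : IsOpen V)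
    {f g : EuclideanSpace ℝ (Fin s) → ℝ} (w : List (Fin s)) (hf : ContDiffOn ℝ w.length f V)
    (hg : ContDiffOn ℝ w.length g V) :
    Set.EqOn (fword w (fun z => f z - g z)) (fun z => fword w f z - fword w g z) V := by
  induction w with
  | nil => exact fun _ _ => rfl
  | cons k w ih =>
    have h1 := pd_congr hV (ih (hf.of_le (by simp)) (hg.of_le (by simp))) k
    refine h1.trans ?_
    intro x hx
    have df : DifferentiableAt ℝ (fword w f) x :=
      ((fword_contDiffOn hV w 1 (by rw [add_comm]; exact hf)).contDiffAt (hV.mem_nhds hx)).differentiableAt (by norm_num)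
    have dg : DifferentiableAt ℝ (fword w g) x :=
      ((fword_contDiffOn hV w 1 (by rw [add_comm]; exact hg)).contDiffAt (hV.mem_nhds hx)).differentiableAt (by norm_num)
    change fderiv ℝ _ x _ = fderiv ℝ _ x _ - fderiv ℝ _ x _
    rw [fderiv_fun_sub df dg]
    rfl

theorem fderiv_apply_eq_sum {s : ℕ} (g : EuclideanSpace ℝ (Fin s) → ℝ)
    (x v : EuclideanSpace ℝ (Fin s)) : fderiv ℝ g x v = ∑ k, v k * pd s k g x := by
  have hv : v = ∑ k, v k • EuclideanSpace.single k (1 : ℝ) := by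
    ext j
    simp [Pi.single_apply]
  conv_lhs => rw [hv]
  rw [map_sum]
  simp [pd]

theorem remainder_bound {s : ℕ} (a : EuclideanSpace ℝ (Fin s)) (r L : ℝ) (hL : 0 ≤ L) (j : ℕ)
    (g : EuclideanSpace ℝ (Fin s) → ℝ) (hg : ContDiffOn ℝ j g (Metric.ball a r))
    (h0 : ∀ w : List (Fin s), w.length ≤ j → fword w g a = 0)
    (hl : ∀ w : List (Fin s), w.length = j → ∀ x ∈ Metric.ball a r,
      |fword w g x| ≤ L * ‖x - a‖) :
    ∀ x ∈ Metric.ball a r, |g x| ≤ L * s ^ j / (j.factorial : ℝ) * ‖x - a‖ ^ (j + 1) := by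
  induction j generalizing g with
  | zero =>
    intro x hx
    simpa [fword] using hl [] rfl x hx
  | succ j ih =>
    have ih' : ∀ k : Fin s, ∀ x ∈ Metric.ball a r,
        |pd s k g x| ≤ L * s ^ j / (j.factorial : ℝ) * ‖x - a‖ ^ (j + 1) := by
      intro k
      have e : ∀ w : List (Fin s), fword w (pd s k g) = fword (w ++ [k]) g := by
        intro w; simp [fword, List.foldr_append]
      apply ih (pd s k g) (pd_contDiffOn Metric.isOpen_ball j hg k)
      · intro w hw
        rw [e]
        exact h0 _ (by simp; exact hw)
      · intro w hw
        rw [e]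
        exact hl _ (by simp; exact hw)
    intro x hx
    set v := x - a with hv
    set C := L * s ^ j / (j.factorial : ℝ) with hC
    have hC0 : 0 ≤ C := by positivity
    have hvr : ‖v‖ < r := by simpa [dist_eq_norm] using hx
    have hmem : ∀ t ∈ Set.Icc (0 : ℝ) 1, a + t • v ∈ Metric.ball a r := by
      intro t ht
      rw [Metric.mem_ball, dist_eq_norm, add_sub_cancel_left, norm_smul, Real.norm_eq_abs,
        abs_of_nonneg ht.1]
      nlinarith [norm_nonneg v, ht.2]
    have hder : ∀ t ∈ Set.Icc (0 : ℝ) 1, HasDerivAt (fun t : ℝ => g (a + t • v))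
        (fderiv ℝ g (a + t • v) v) t := by
      intro t ht
      have h1 : DifferentiableAt ℝ g (a + t • v) :=
        (hg.contDiffAt (Metric.isOpen_ball.mem_nhds (hmem t ht))).differentiableAt (by simp)
      have h2 : HasDerivAt (fun t : ℝ => a + t • v) v t := by
        have := ((hasDerivAt_id t).smul_const v).const_add a
        exact HasDerivAt.congr_deriv this (by simp)
      exact h1.hasFDerivAt.comp_hasDerivAt t h2
    have hB : ∀ t : ℝ, HasDerivAt (fun t : ℝ => (s * C * ‖v‖ ^ (j + 2) / (j + 2)) * t ^ (j + 2))
        (s * C * ‖v‖ ^ (j + 2) * t ^ (j + 1)) t := by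
      intro t
      have := (hasDerivAt_pow (j + 2) t).const_mul (s * C * ‖v‖ ^ (j + 2) / (j + 2) : ℝ)
      refine HasDerivAt.congr_deriv this ?_
      push_cast
      have : (j : ℝ) + 2 ≠ 0 := by positivity
      field_simp
    have hfin := image_norm_le_of_norm_deriv_right_le_deriv_boundary
      (f := fun t : ℝ => g (a + t • v)) (f' := fun t => fderiv ℝ g (a + t • v) v)
      (a := 0) (b := 1)
      (B := fun t : ℝ => (s * C * ‖v‖ ^ (j + 2) / (j + 2)) * t ^ (j + 2))
      (B' := fun t : ℝ => s * C * ‖v‖ ^ (j + 2) * t ^ (j + 1))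
      (fun t ht => (hder t ht).continuousAt.continuousWithinAt)
      (fun t ht => (hder t ⟨ht.1, ht.2.le⟩).hasDerivWithinAt)
      (by
        have := h0 [] (by simp)
        simp only [fword, List.foldr_nil] at this
        simp [this])
      hB
      (by
        intro t ht
        have ht' : t ∈ Set.Icc (0 : ℝ) 1 := ⟨ht.1, ht.2.le⟩
        rw [fderiv_apply_eq_sum, Real.norm_eq_abs]
        refine (Finset.abs_sum_le_sum_abs _ _).trans ?_
        have : ∀ k ∈ (Finset.univ : Finset (Fin s)), |v k * pd s k g (a + t • v)| ≤
            ‖v‖ * (C * (t * ‖v‖) ^ (j + 1)) := by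
          intro k _
          rw [abs_mul]
          have h1 := ih' k _ (hmem t ht')
          rw [add_sub_cancel_left, norm_smul, Real.norm_eq_abs, abs_of_nonneg ht.1] at h1
          have h2 : |v k| ≤ ‖v‖ := by
            simpa using PiLp.norm_apply_le v k
          gcongr
        refine (Finset.sum_le_sum this).trans ?_
        rw [Finset.sum_const, Finset.card_univ, Fintype.card_fin, nsmul_eq_mul]
        apply le_of_eq
        ring)
      (x := 1) (by simp)
    have hx1 : a + (1 : ℝ) • v = x := by simp [hv]
    simp only [hx1, Real.norm_eq_abs, one_pow, mul_one] at hfin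
    refine hfin.trans ?_
    have hfac : ((j + 1).factorial : ℝ) = (j + 1) * j.factorial := by
      rw [Nat.factorial_succ]; push_cast; ring
    have e2 : L * s ^ (j + 1) / ((j + 1).factorial : ℝ) * ‖v‖ ^ (j + 1 + 1)
        = s * C * ‖v‖ ^ (j + 2) / (j + 1) := by
      rw [hfac, hC]; field_simp; ring
    rw [e2]
    gcongr
    norm_num

/-- shifted monomial -/
def mon {s : ℕ} (a : Fin s → ℝ) (β : Fin s → ℕ) : MvPolynomial (Fin s) ℝ :=
  ∏ k, (MvPolynomial.X k - MvPolynomial.C (a k)) ^ β k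

theorem pderiv_mon {s : ℕ} (a : Fin s → ℝ) (β : Fin s → ℕ) (k : Fin s) :
    MvPolynomial.pderiv k (mon a β) =
      MvPolynomial.C (β k : ℝ) * mon a (fun j => β j - if j = k then 1 else 0) := by
  have hz : MvPolynomial.pderiv k (∏ j ∈ Finset.univ.erase k,
      (MvPolynomial.X j - MvPolynomial.C (a j) : MvPolynomial (Fin s) ℝ) ^ β j) = 0 := by
    apply Finset.prod_induction _ (fun q : MvPolynomial (Fin s) ℝ => MvPolynomial.pderiv k q = 0)
    · intro p q hp hq
      rw [MvPolynomial.pderiv_mul, hp, hq]; simp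
    · exact MvPolynomial.pderiv_one
    · intro j hj
      have hjk : j ≠ k := (Finset.mem_erase.mp hj).1
      rw [MvPolynomial.pderiv_pow, map_sub, MvPolynomial.pderiv_X_of_ne hjk, MvPolynomial.pderiv_C]
      simp
  rw [mon, ← Finset.mul_prod_erase _ _ (Finset.mem_univ k), MvPolynomial.pderiv_mul, hz, mul_zero,
    add_zero, MvPolynomial.pderiv_pow, map_sub, MvPolynomial.pderiv_X_self, MvPolynomial.pderiv_C,
    mon, ← Finset.mul_prod_erase _ _ (Finset.mem_univ k)]
  have : ∏ j ∈ Finset.univ.erase k, (MvPolynomial.X j - MvPolynomial.C (a j) :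
      MvPolynomial (Fin s) ℝ) ^ (β j - if j = k then 1 else 0) =
      ∏ j ∈ Finset.univ.erase k, (MvPolynomial.X j - MvPolynomial.C (a j)) ^ β j := by
    apply Finset.prod_congr rfl
    intro j hj
    rw [if_neg (Finset.mem_erase.mp hj).1, Nat.sub_zero]
  rw [this]
  simp
  ring

theorem pword_mon {s : ℕ} (a : Fin s → ℝ) (β : Fin s → ℕ) (w : List (Fin s)) :
    pword w (mon a β) =
      MvPolynomial.C (∏ k, ((β k).descFactorial (w.count k) : ℝ)) *
        mon a (fun j => β j - w.count j) := by
  induction w with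
  | nil => simp [pword]
  | cons k w ih =>
    have e : pword (k :: w) (mon a β) = MvPolynomial.pderiv k (pword w (mon a β)) := rfl
    rw [e, ih, MvPolynomial.pderiv_C_mul, pderiv_mon, ← mul_assoc, ← MvPolynomial.C_mul]
    congr 2
    · have : ∀ j, ((β j).descFactorial ((k :: w).count j) : ℝ) =
          ((β j).descFactorial (w.count j) : ℝ) *
            (if j = k then ((β j - w.count j : ℕ) : ℝ) else 1) := by
        intro j
        rw [List.count_cons]
        by_cases h : j = k
        · subst h
          simp [Nat.descFactorial_succ]
          ring
        · have h' : ¬ k = j := fun h2 => h h2.symm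
          simp [h, h']
      rw [Finset.prod_congr rfl (fun j _ => this j), Finset.prod_mul_distrib]
      simp
    · funext j
      rw [List.count_cons]
      by_cases h : j = k
      · subst h; simp; omega
      · have h' : ¬ k = j := fun h2 => h h2.symm
        simp [h, h']

theorem pword_add {s : ℕ} (w : List (Fin s)) (p q : MvPolynomial (Fin s) ℝ) :
    pword w (p + q) = pword w p + pword w q := by
  induction w with
  | nil => rfl
  | cons k w ih =>
    change MvPolynomial.pderiv k (pword w (p + q)) = _
    rw [ih, map_add]; rfl

theorem pword_C_mul {s : ℕ} (w : List (Fin s)) (c : ℝ) (q : MvPolynomial (Fin s) ℝ) :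
    pword w (MvPolynomial.C c * q) = MvPolynomial.C c * pword w q := by
  induction w with
  | nil => rfl
  | cons k w ih =>
    change MvPolynomial.pderiv k (pword w _) = _
    rw [ih, MvPolynomial.pderiv_C_mul]; rfl

theorem pword_sum {s : ℕ} {ι : Type*} (w : List (Fin s)) (S : Finset ι)
    (q : ι → MvPolynomial (Fin s) ℝ) :
    pword w (∑ i ∈ S, q i) = ∑ i ∈ S, pword w (q i) := by
  classical
  induction S using Finset.induction_on with
  | empty =>
    have := pword_C_mul w 0 0
    simpa using this
  | insert i S hi ih => rw [Finset.sum_insert hi, Finset.sum_insert hi, pword_add, ih]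

theorem totalDegree_mon_le {s : ℕ} (a : Fin s → ℝ) (β : Fin s → ℕ) :
    (mon a β).totalDegree ≤ mdeg s β := by
  refine (MvPolynomial.totalDegree_finsetProd _ _).trans ?_
  apply Finset.sum_le_sum
  intro k _
  refine (MvPolynomial.totalDegree_pow _ _).trans ?_
  have : (MvPolynomial.X k - MvPolynomial.C (a k) : MvPolynomial (Fin s) ℝ).totalDegree ≤ 1 := by
    refine (MvPolynomial.totalDegree_sub _ _).trans ?_
    simp
  nlinarith

theorem exists_taylor {s : ℕ} (a : Fin s → ℝ) (d : ℕ) (c : (Fin s → ℕ) → ℝ) :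
    ∃ T : MvPolynomial (Fin s) ℝ, T.totalDegree ≤ d ∧
      ∀ ν : Fin s → ℕ, mdeg s ν ≤ d → MvPolynomial.eval a (pword (canon ν) T) = c ν := by
  classical
  set S : Finset (Fin s → ℕ) :=
    (Fintype.piFinset (fun _ : Fin s => Finset.range (d + 1))).filter (fun β => mdeg s β ≤ d) with hS
  refine ⟨∑ β ∈ S, MvPolynomial.C (c β / ∏ k, ((β k).factorial : ℝ)) * mon a β, ?_, ?_⟩
  · apply MvPolynomial.totalDegree_finsetSum_le
    intro β hβ
    refine (MvPolynomial.totalDegree_mul _ _).trans ?_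
    rw [MvPolynomial.totalDegree_C, zero_add]
    exact (totalDegree_mon_le a β).trans (Finset.mem_filter.mp hβ).2
  · intro ν hν
    have hνS : ν ∈ S := by
      rw [hS, Finset.mem_filter, Fintype.mem_piFinset]
      refine ⟨fun k => ?_, hν⟩
      rw [Finset.mem_range]
      have : ν k ≤ mdeg s ν := Finset.single_le_sum (f := ν) (fun _ _ => Nat.zero_le _) (Finset.mem_univ k)
      omega
    rw [pword_sum, map_sum, Finset.sum_eq_single_of_mem ν hνS]
    · rw [pword_C_mul, pword_mon]
      have : (∏ k, ((ν k).factorial : ℝ)) ≠ 0 :=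
        Finset.prod_ne_zero_iff.mpr (fun k _ => by positivity)
      simp [count_canon, mon, Nat.descFactorial_self, this]
    · intro β hβ hne
      rw [pword_C_mul, pword_mon]
      simp only [count_canon, map_mul, MvPolynomial.eval_C, mon, map_prod, map_pow, map_sub,
        MvPolynomial.eval_X, sub_self]
      obtain ⟨k, hk⟩ := Function.ne_iff.mp hne
      rcases lt_or_gt_of_ne hk with h | h
      · rw [Finset.prod_eq_zero (f := fun i => ((β i).descFactorial (ν i) : ℝ)) (Finset.mem_univ k) (by
          rw [Nat.descFactorial_of_lt h, Nat.cast_zero])]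
        simp
      · rw [Finset.prod_eq_zero (f := fun i => (0 : ℝ) ^ (β i - ν i)) (Finset.mem_univ k) (by
          exact zero_pow (by omega))]
        simp

theorem semi_bddAbove {s d : ℕ} {f : EuclideanSpace ℝ (Fin s) → ℝ}
    {Ω K : Set (EuclideanSpace ℝ (Fin s))} (hf : Cd1 s d f Ω) (hK : K ⊆ Ω) :
    BddAbove { r : ℝ | ∃ (ν : Fin s → ℕ) (u v : EuclideanSpace ℝ (Fin s)),
    mdeg s ν = d ∧ u ∈ K ∧ v ∈ K ∧ u ≠ v ∧
    r = |Dmulti s ν f u - Dmulti s ν f v| / ‖u - v‖ } := by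
  classical
  choose! L hL using hf.2
  set S : Finset (Fin s → ℕ) := Fintype.piFinset (fun _ : Fin s => Finset.range (d + 1)) with hS
  refine ⟨((∑ β ∈ S, L β : NNReal) : ℝ), ?_⟩
  rintro r ⟨ν, u, v, hν, hu, hv, huv, rfl⟩
  have hνS : ν ∈ S := by
    rw [hS, Fintype.mem_piFinset]
    intro k
    rw [Finset.mem_range]
    have : ν k ≤ mdeg s ν := Finset.single_le_sum (f := ν) (fun _ _ => Nat.zero_le _) (Finset.mem_univ k)
    omega
  rw [div_le_iff₀ (norm_pos_iff.mpr (sub_ne_zero.mpr huv))]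
  have h1 := (hL ν hν).dist_le_mul u (hK hu) v (hK hv)
  rw [Real.dist_eq, dist_eq_norm] at h1
  refine h1.trans ?_
  have h2 : L ν ≤ ∑ β ∈ S, L β := Finset.single_le_sum (f := L) (fun _ _ => zero_le) hνS
  gcongr

theorem semi_bound {s d : ℕ} {f : EuclideanSpace ℝ (Fin s) → ℝ}
    {Ω K : Set (EuclideanSpace ℝ (Fin s))} (hf : Cd1 s d f Ω) (hK : K ⊆ Ω)
    (ν : Fin s → ℕ) (hν : mdeg s ν = d) (u v : EuclideanSpace ℝ (Fin s)) (hu : u ∈ K)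
    (hv : v ∈ K) : |Dmulti s ν f u - Dmulti s ν f v| ≤ semi s d f K * ‖u - v‖ := by
  by_cases huv : u = v
  · simp [huv]
  · rw [← div_le_iff₀ (norm_pos_iff.mpr (sub_ne_zero.mpr huv))]
    exact le_csSup (semi_bddAbove hf hK) ⟨ν, u, v, hν, hu, hv, huv, rfl⟩

theorem semi_nonneg {s d : ℕ} (f : EuclideanSpace ℝ (Fin s) → ℝ)
    (K : Set (EuclideanSpace ℝ (Fin s))) : 0 ≤ semi s d f K := by
  apply Real.sSup_nonneg
  rintro r ⟨ν, u, v, -, -, -, -, rfl⟩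
  positivity

theorem lebesgue_bound {s m : ℕ} (ℓ : Fin m → MvPolynomial (Fin s) ℝ)
    {Ω : Set (EuclideanSpace ℝ (Fin s))} (hΩ : IsCompact Ω) (x : EuclideanSpace ℝ (Fin s))
    (hx : x ∈ Ω) : ∑ i, |MvPolynomial.eval (fun k => x k) (ℓ i)| ≤ lebesgue s m ℓ Ω := by
  apply le_csSup
  · apply (hΩ.image _).bddAbove
    apply continuous_finsetSum
    intro i _
    exact (contDiff_eval (ℓ i) 0).continuous.abs
  · exact ⟨x, hx, rfl⟩

theorem taylor_remainder {s d : ℕ} {f : EuclideanSpace ℝ (Fin s) → ℝ}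
    {Ω : Set (EuclideanSpace ℝ (Fin s))} (hf : Cd1 s d f Ω) (a : EuclideanSpace ℝ (Fin s))
    (h : ℝ) (hh : 0 < h) (hball : Metric.closedBall a h ⊆ Ω)
    (T : MvPolynomial (Fin s) ℝ) (hT : T.totalDegree ≤ d)
    (hTν : ∀ ν : Fin s → ℕ, mdeg s ν ≤ d →
      MvPolynomial.eval (fun k => a k) (pword (canon ν) T) = Dmulti s ν f a) :
    ∀ x ∈ Metric.closedBall a h, |f x - MvPolynomial.eval (fun k => x k) T| ≤
      semi s d f (Metric.closedBall a h) * s ^ d / (d.factorial : ℝ) * ‖x - a‖ ^ (d + 1) := by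
  have hfV : ContDiffOn ℝ d f (Metric.ball a h) :=
    hf.1.mono (Metric.ball_subset_closedBall.trans hball)
  have haV : a ∈ Metric.ball a h := Metric.mem_ball_self hh
  have hTc : ∀ n : ℕ, ContDiffOn ℝ n
      (fun z : EuclideanSpace ℝ (Fin s) => MvPolynomial.eval (fun k => z k) T) (Metric.ball a h) :=
    fun n => (contDiff_eval T n).contDiffOn
  have hperm : ∀ w : List (Fin s), w.length ≤ d → ∀ x ∈ Metric.ball a h,
      fword w f x = Dmulti s (fun k => w.count k) f x := by
    intro w hw x hx
    rw [Dmulti_eq_fword]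
    exact fword_perm Metric.isOpen_ball (perm_canon w) (hfV.of_le (by exact_mod_cast hw)) hx
  have hmd : ∀ w : List (Fin s), mdeg s (fun k => w.count k) = w.length := by
    intro w
    rw [← length_canon, (perm_canon w).length_eq]
  have hagree : ∀ w : List (Fin s), w.length ≤ d →
      MvPolynomial.eval (fun k => a k) (pword w T) = fword w f a := by
    intro w hw
    rw [hperm w hw a haV, ← hTν _ (by rw [hmd]; exact hw)]
    have := fword_perm Metric.isOpen_ball (perm_canon w) (hTc _) haV
    rwa [fword_eval, fword_eval] at this
  have hopen := remainder_bound a h (semi s d f (Metric.closedBall a h)) (semi_nonneg _ _) d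
    (fun z => f z - MvPolynomial.eval (fun k => z k) T) (hfV.sub (hTc d))
    (by
      intro w hw
      rw [fword_sub Metric.isOpen_ball w (hfV.of_le (by exact_mod_cast hw)) (hTc _) haV]
      simp only [fword_eval]
      rw [hagree w hw, sub_self])
    (by
      intro w hw x hx
      rw [fword_sub Metric.isOpen_ball w (hfV.of_le (by exact_mod_cast hw.le)) (hTc _) hx]
      simp only [fword_eval]
      have hdeg := totalDegree_pword_le w T
      have hc : (pword w T).totalDegree = 0 := by omega
      rw [MvPolynomial.totalDegree_eq_zero_iff_eq_C] at hc
      have e : MvPolynomial.eval (fun k => x k) (pword w T) = fword w f a := by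
        rw [← hagree w hw.le, hc]; simp
      rw [e, hperm w hw.le x hx, hperm w hw.le a haV]
      exact semi_bound hf hball _ (by rw [hmd, hw]) x a (Metric.ball_subset_closedBall hx)
        (Metric.ball_subset_closedBall haV))
  intro x hx
  rw [← closure_ball a hh.ne'] at hx
  refine le_on_closure (f := fun x => |f x - MvPolynomial.eval (fun k => x k) T|) hopen ?_ ?_ hx
  · rw [closure_ball a hh.ne']
    exact ((hf.1.continuousOn.mono hball).sub (contDiff_eval T 0).continuous.continuousOn).abs
  · apply Continuous.continuousOn
    fun_prop

theorem stmt5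
    (s d m : ℕ) (hs : 1 ≤ s) (hd : 1 ≤ d) (hm : m = Nat.choose (d + s) s)
    (x : Fin m → EuclideanSpace ℝ (Fin s))
    (huni : Unisolvent s d m x)
    (ℓ : Fin m → MvPolynomial (Fin s) ℝ) (hℓ : IsLagrangeBasis s d m x ℓ)
    (Ω : Set (EuclideanSpace ℝ (Fin s)))
    (hΩconv : Convex ℝ Ω) (hΩcomp : IsCompact Ω) (hΩint : (interior Ω).Nonempty)
    (hxΩ : ∀ i, x i ∈ Ω)
    (xbar : EuclideanSpace ℝ (Fin s))
    (f : EuclideanSpace ℝ (Fin s) → ℝ) (hf : Cd1 s d f Ω)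
    (h : ℝ) (hh : IsGreatest (Set.range fun i => ‖x i - xbar‖) h)
    (hball : Metric.closedBall xbar h ⊆ Ω)
    (K : Set (EuclideanSpace ℝ (Fin s))) (hK : K = Metric.closedBall xbar h)
    (y : Fin m → ℝ) (hy : y = fun i => f (x i))
    (ν : Fin s → ℕ) (hν : mdeg s ν ≤ d) :
    |Dmulti s ν f xbar - Dmulti s ν (interp s m ℓ y) xbar| ≤
      semi s d f K * kconst s d * Mconst d ν * lebesgue s m ℓ Ω *
        h ^ (d - mdeg s ν + 1) := by
  subst hK hy
  have hm2 : 2 ≤ m := by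
    rw [hm]
    calc 2 ≤ s + 1 := by omega
      _ = (s + 1).choose s := by simp
      _ ≤ (d + s).choose s := Nat.choose_le_choose s (by omega)
  have hxi : ∀ i, ‖x i - xbar‖ ≤ h := fun i => hh.2 ⟨i, rfl⟩
  have hh0 : 0 < h := by
    by_contra hneg
    have hx0 : ∀ i, x i = xbar := by
      intro i
      have := hxi i
      exact sub_eq_zero.mp (norm_le_zero_iff.mp (by linarith))
    have := huni.1 ((hx0 ⟨0, by omega⟩).trans (hx0 ⟨1, by omega⟩).symm)
    simp at this
  obtain ⟨T, hTd, hTν⟩ := exists_taylor (fun k => xbar k) d (fun ν => Dmulti s ν f xbar)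
  have hR := taylor_remainder hf xbar h hh0 hball T hTd hTν
  set A := semi s d f (Metric.closedBall xbar h) with hA
  have hA0 : 0 ≤ A := semi_nonneg _ _
  set R := A * kconst s d * h ^ (d + 1) with hRdef
  have hk0 : 0 ≤ kconst s d := by
    unfold kconst; split_ifs <;> positivity
  have hR0 : 0 ≤ R := by positivity
  have hRi : ∀ i, |f (x i) - MvPolynomial.eval (fun k => x i k) T| ≤ R := by
    intro i
    refine (hR (x i) (by simpa [dist_eq_norm] using hxi i)).trans ?_
    have h1 : A * s ^ d / (d.factorial : ℝ) ≤ A * kconst s d := by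
      rw [kconst, if_neg (by omega), mul_div_assoc]
      have : ((d - 1).factorial : ℝ) ≤ d.factorial := by
        exact_mod_cast Nat.factorial_le (by omega)
      gcongr
    have := hxi i
    rw [hRdef]
    gcongr
  -- the remainder polynomial
  set r : Fin m → ℝ := fun i => f (x i) - MvPolynomial.eval (fun k => x i k) T with hr
  set Q : MvPolynomial (Fin s) ℝ := ∑ i, MvPolynomial.C (r i) * ℓ i with hQ
  have hQd : Q.totalDegree ≤ d := by
    apply MvPolynomial.totalDegree_finsetSum_le
    intro i _
    refine (MvPolynomial.totalDegree_mul _ _).trans ?_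
    rw [MvPolynomial.totalDegree_C, zero_add]
    exact hℓ.1 i
  have hLd : ∀ y : Fin m → ℝ,
      (∑ i, MvPolynomial.C (y i) * ℓ i).totalDegree ≤ d := by
    intro y
    apply MvPolynomial.totalDegree_finsetSum_le
    intro i _
    refine (MvPolynomial.totalDegree_mul _ _).trans ?_
    rw [MvPolynomial.totalDegree_C, zero_add]
    exact hℓ.1 i
  have hTint : T = ∑ i, MvPolynomial.C (MvPolynomial.eval (fun k => x i k) T) * ℓ i := by
    obtain ⟨p, -, hp⟩ := huni.2 (fun i => MvPolynomial.eval (fun k => x i k) T)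
    rw [hp T ⟨hTd, fun i => rfl⟩]
    refine (hp _ ⟨hLd _, fun j => ?_⟩).symm
    rw [map_sum]
    simp [hℓ.2, hp T ⟨hTd, fun i => rfl⟩]
  have hinterp : interp s m ℓ (fun i => f (x i)) =
      fun z => MvPolynomial.eval (fun k => z k) (T + Q) := by
    funext z
    have : T + Q = ∑ i, MvPolynomial.C (f (x i)) * ℓ i := by
      conv_lhs => rw [hTint]
      rw [hQ, ← Finset.sum_add_distrib]
      apply Finset.sum_congr rfl
      intro i _
      rw [← add_mul, ← MvPolynomial.C_add, hr]
      simp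
    rw [this, interp, map_sum]
    simp
  have hQb : ∀ z ∈ Metric.closedBall xbar h,
      |MvPolynomial.eval (fun k => z k) Q| ≤ R * lebesgue s m ℓ Ω := by
    intro z hz
    rw [hQ, map_sum]
    refine (Finset.abs_sum_le_sum_abs _ _).trans ?_
    have h1 := lebesgue_bound ℓ hΩcomp z (hball hz)
    calc _ ≤ ∑ i, R * |MvPolynomial.eval (fun k => z k) (ℓ i)| := by
          apply Finset.sum_le_sum
          intro i _
          rw [map_mul, MvPolynomial.eval_C, abs_mul]
          exact mul_le_mul_of_nonneg_right (hRi i) (abs_nonneg _)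
      _ = R * ∑ i, |MvPolynomial.eval (fun k => z k) (ℓ i)| := by rw [Finset.mul_sum]
      _ ≤ _ := mul_le_mul_of_nonneg_left h1 hR0
  have hΛ0 : 0 ≤ R * lebesgue s m ℓ Ω :=
    (abs_nonneg _).trans (hQb xbar (Metric.mem_closedBall_self hh0.le))
  have hfin := pword_center d Q hQd xbar h _ hΛ0 hQb hh0 (canon ν) (by rw [length_canon]; exact hν)
  rw [length_canon] at hfin
  have hDi : Dmulti s ν (interp s m ℓ (fun i => f (x i))) xbar =
      Dmulti s ν f xbar + MvPolynomial.eval (fun k => xbar k) (pword (canon ν) Q) := by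
    rw [hinterp, Dmulti_eq_fword, fword_eval]
    simp only [pword_add, map_add]
    rw [hTν ν hν]
  rw [hDi, sub_add_cancel_left, abs_neg]
  have hpos : 0 < h ^ mdeg s ν := by positivity
  refine le_of_mul_le_mul_right (hfin.trans (le_of_eq ?_)) hpos
  rw [hRdef, Mconst]
  have : h ^ (d + 1) = h ^ (d - mdeg s ν + 1) * h ^ mdeg s ν := by
    rw [← pow_add]; congr 1; omega
  rw [this]
  ring

end
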